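/- Under the stated assumptions, the expectation of the effective-noise denominator has the closed form E[Z] = M_rx ( β(0,0) E^{(r)} e^{−v} N_0 T_cs/T_s + N_0² T_cs/(D_2 T_s) + β(0,0) (N_0/D_2) E_k ). -/

import Mathlib

open Real Finset MeasureTheory ProbabilityTheory

/-- The conjugate inner product `u† v = Σ_i conj(u_i) v_i`. -/
noncomputable def dotc {M : ℕ} (u v : Fin M → ℂ) : ℂ :=
  ∑ i, (starRingEnd ℂ) (u i) * v i

/-- The frequency-domain channel matrix `Σ_ℓ α_ℓ a_rx(ℓ) a_tx(ℓ)† e^{−2πi f τ_ℓ}`. -/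
noncomputable def chanMat {L Mtx Mrx : ℕ} (α : Fin L → ℂ)
    (arx : Fin L → Fin Mrx → ℂ) (atx : Fin L → Fin Mtx → ℂ)
    (τ : Fin L → ℝ) (f : ℝ) : Matrix (Fin Mrx) (Fin Mtx) ℂ :=
  ∑ ℓ, (α ℓ * Complex.exp (((-(2 * π * f * τ ℓ)) : ℝ) * Complex.I)) •
    Matrix.vecMulVec (arx ℓ) (star (atx ℓ))

/-- The frequency-selective coupling coefficient
`β(ḟ, f̈) = Σ_ℓ |α_ℓ|² |a_tx(ℓ)† t|² e^{i(2π ḟ (τ̂_ℓ − τ_ℓ) − 2π f̈ τ_ℓ)}`. -/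
noncomputable def betaCoef {L Mtx : ℕ} (α : Fin L → ℂ) (atx : Fin L → Fin Mtx → ℂ)
    (τhat τ : Fin L → ℝ) (t : Fin Mtx → ℂ) (fdot fddot : ℝ) : ℂ :=
  ∑ ℓ, ((‖α ℓ‖ ^ 2 * ‖dotc (atx ℓ) t‖ ^ 2 : ℝ) : ℂ) *
    Complex.exp (((2 * π * fdot * (τhat ℓ - τ ℓ) - 2 * π * fddot * τ ℓ) : ℝ) * Complex.I)

/-- `β(0,0) = Σ_ℓ |α_ℓ|² |a_tx(ℓ)† t|²`. -/
noncomputable def betaZero {L Mtx : ℕ} (α : Fin L → ℂ) (atx : Fin L → Fin Mtx → ℂ)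
    (t : Fin Mtx → ℂ) : ℝ :=
  ∑ ℓ, ‖α ℓ‖ ^ 2 * ‖dotc (atx ℓ) t‖ ^ 2


/-- Pythagoras for a family of mutually orthogonal vectors of common squared norm `M`. -/
theorem sum_norm_sq_sum_mul_of_orthogonal {L M : ℕ} (a : Fin L → Fin M → ℂ)
    (horth : ∀ ℓ m, ℓ ≠ m → dotc (a ℓ) (a m) = 0)
    (hnorm : ∀ ℓ, dotc (a ℓ) (a ℓ) = (M : ℂ)) (c : Fin L → ℂ) :
    ∑ i, ‖∑ ℓ, c ℓ * a ℓ i‖ ^ 2 = M * ∑ ℓ, ‖c ℓ‖ ^ 2 := by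
  have key : ∀ ℓ m, dotc (a ℓ) (a m) = if ℓ = m then (M : ℂ) else 0 := by
    intro ℓ m
    split_ifs with h
    · rw [← h, hnorm]
    · exact horth ℓ m h
  apply Complex.ofReal_injective
  push_cast
  calc ∑ i, (‖∑ ℓ, c ℓ * a ℓ i‖ : ℂ) ^ 2
      = ∑ i, ∑ ℓ, ∑ m, (starRingEnd ℂ) (c ℓ) * c m * ((starRingEnd ℂ) (a ℓ i) * a m i) := by
        refine Finset.sum_congr rfl fun i _ => ?_
        rw [← Complex.conj_mul', map_sum, Finset.sum_mul_sum]
        refine Finset.sum_congr rfl fun ℓ _ => Finset.sum_congr rfl fun m _ => ?_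
        rw [map_mul]
        ring
    _ = ∑ ℓ, ∑ m, (starRingEnd ℂ) (c ℓ) * c m * dotc (a ℓ) (a m) := by
        rw [Finset.sum_comm]
        refine Finset.sum_congr rfl fun ℓ _ => ?_
        rw [Finset.sum_comm]
        refine Finset.sum_congr rfl fun m _ => ?_
        rw [dotc, Finset.mul_sum]
    _ = (M : ℂ) * ∑ ℓ, (‖c ℓ‖ : ℂ) ^ 2 := by
        simp only [key, mul_ite, mul_zero, Finset.sum_ite_eq, Finset.mem_univ, if_true,
          Complex.conj_mul', ← Finset.sum_mul]
        ring

theorem chanMat_mulVec_apply {L Mtx Mrx : ℕ} (α : Fin L → ℂ)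
    (arx : Fin L → Fin Mrx → ℂ) (atx : Fin L → Fin Mtx → ℂ)
    (τ : Fin L → ℝ) (f : ℝ) (t : Fin Mtx → ℂ) (i : Fin Mrx) :
    (chanMat α arx atx τ f).mulVec t i =
      ∑ ℓ, (α ℓ * Complex.exp (((-(2 * π * f * τ ℓ)) : ℝ) * Complex.I) * dotc (atx ℓ) t) *
        arx ℓ i := by
  rw [chanMat, Matrix.sum_mulVec, Finset.sum_apply]
  refine Finset.sum_congr rfl fun ℓ _ => ?_
  simp only [Matrix.mulVec, dotProduct, Matrix.smul_apply, Matrix.vecMulVec_apply, dotc,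
    Pi.star_apply, smul_eq_mul, Finset.mul_sum, Finset.sum_mul, starRingEnd_apply]
  refine Finset.sum_congr rfl fun j _ => ?_
  ring

theorem sum_norm_sq_chanMat_mulVec {L Mtx Mrx : ℕ} (α : Fin L → ℂ)
    (arx : Fin L → Fin Mrx → ℂ) (atx : Fin L → Fin Mtx → ℂ)
    (horth : ∀ ℓ m, ℓ ≠ m → dotc (arx ℓ) (arx m) = 0)
    (hnorm : ∀ ℓ, dotc (arx ℓ) (arx ℓ) = (Mrx : ℂ))
    (τ : Fin L → ℝ) (f : ℝ) (t : Fin Mtx → ℂ) :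
    ∑ i, ‖(chanMat α arx atx τ f).mulVec t i‖ ^ 2 = Mrx * betaZero α atx t := by
  simp only [chanMat_mulVec_apply]
  rw [sum_norm_sq_sum_mul_of_orthogonal arx horth hnorm, betaZero]
  simp only [norm_mul, Complex.norm_exp_ofReal_mul_I, mul_one, mul_pow]

section SecondMoments

variable {Ω : Type*} {mΩ : MeasurableSpace Ω} {P : Measure Ω}

theorem MeasureTheory.MemLp.integrable_mul_conj {f g : Ω → ℂ} (hf : MemLp f 2 P)
    (hg : MemLp g 2 P) : Integrable (fun ω => f ω * (starRingEnd ℂ) (g ω)) P :=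
  hf.integrable_mul hg.star

theorem integrable_norm_const_add_sq [IsFiniteMeasure P] {f : Ω → ℂ} (hf : MemLp f 2 P)
    (c : ℂ) : Integrable (fun ω => ‖c + f ω‖ ^ 2) P :=
  ((memLp_const c).add hf).integrable_norm_pow two_ne_zero

theorem integral_norm_const_add_sq [IsProbabilityMeasure P] {f : Ω → ℂ} (hf : MemLp f 2 P)
    (hmean : ∫ ω, f ω ∂P = 0) (c : ℂ) :
    ((∫ ω, ‖c + f ω‖ ^ 2 ∂P : ℝ) : ℂ) =
      (‖c‖ : ℂ) ^ 2 + ∫ ω, f ω * (starRingEnd ℂ) (f ω) ∂P := by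
  have hf1 : Integrable f P := hf.integrable one_le_two
  have hf1' : Integrable (fun ω => (starRingEnd ℂ) (f ω)) P :=
    (hf.star.integrable one_le_two :)
  have hff := hf.integrable_mul_conj hf
  have expand : ∀ ω, ((‖c + f ω‖ ^ 2 : ℝ) : ℂ) =
      (‖c‖ : ℂ) ^ 2 + c * (starRingEnd ℂ) (f ω) + (starRingEnd ℂ) c * f ω +
        f ω * (starRingEnd ℂ) (f ω) := by
    intro ω
    push_cast
    rw [← Complex.mul_conj', ← Complex.mul_conj', map_add]
    ring
  rw [← integral_complex_ofReal]
  simp only [expand]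
  have h1 : Integrable (fun ω => c * (starRingEnd ℂ) (f ω)) P := hf1'.const_mul c
  have h2 : Integrable (fun ω => (starRingEnd ℂ) c * f ω) P := hf1.const_mul _
  have h3 : Integrable (fun ω => (‖c‖ : ℂ) ^ 2 + c * (starRingEnd ℂ) (f ω)) P :=
    (integrable_const _).add h1
  have h4 : Integrable (fun ω => (‖c‖ : ℂ) ^ 2 + c * (starRingEnd ℂ) (f ω) +
      (starRingEnd ℂ) c * f ω) P := h3.add h2
  rw [integral_add h4 hff, integral_add h3 h2, integral_add (integrable_const _) h1,
    integral_const_mul, integral_const_mul, integral_conj, hmean]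
  simp

theorem integrable_norm_dotc_sq {M : ℕ} {W : Ω → Fin M → ℂ}
    (hW : ∀ m, MemLp (fun ω => W ω m) 2 P) (h : Fin M → ℂ) :
    Integrable (fun ω => ‖dotc (W ω) h‖ ^ 2) P := by
  refine MemLp.integrable_norm_pow ?_ two_ne_zero
  simp only [dotc]
  exact memLp_finsetSum _ fun i _ => ((hW i).star.mul_const (h i) :)

theorem integral_norm_dotc_sq {M : ℕ} {W : Ω → Fin M → ℂ}
    (hW : ∀ m, MemLp (fun ω => W ω m) 2 P) {σ : ℝ}
    (hcov : ∀ m n, ∫ ω, W ω m * (starRingEnd ℂ) (W ω n) ∂P = if m = n then (σ : ℂ) else 0)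
    (h : Fin M → ℂ) :
    ∫ ω, ‖dotc (W ω) h‖ ^ 2 ∂P = σ * ∑ i, ‖h i‖ ^ 2 := by
  have expand : ∀ ω, ((‖dotc (W ω) h‖ ^ 2 : ℝ) : ℂ) =
      ∑ i, ∑ j, W ω i * (starRingEnd ℂ) (W ω j) * ((starRingEnd ℂ) (h i) * h j) := by
    intro ω
    push_cast
    rw [← Complex.conj_mul', dotc, map_sum, Finset.sum_mul_sum]
    refine Finset.sum_congr rfl fun i _ => Finset.sum_congr rfl fun j _ => ?_
    rw [map_mul, Complex.conj_conj]
    ring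
  have hint : ∀ i j, Integrable
      (fun ω => W ω i * (starRingEnd ℂ) (W ω j) * ((starRingEnd ℂ) (h i) * h j)) P :=
    fun i j => ((hW i).integrable_mul_conj (hW j)).mul_const _
  apply Complex.ofReal_injective
  rw [← integral_complex_ofReal]
  simp only [expand]
  rw [integral_finsetSum _ fun i _ => integrable_finsetSum _ fun j _ => hint i j]
  simp only [integral_finsetSum _ fun j _ => hint _ j, integral_mul_const, hcov, ite_mul,
    zero_mul, Finset.sum_ite_eq, Finset.mem_univ, if_true, Complex.conj_mul', Finset.mul_sum]
  push_cast
  rfl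

end SecondMoments

/-- Closed form for the expectation of the effective-noise denominator:
`E[Z] = M_rx (β(0,0) E⁽ʳ⁾ e^{−v} N₀ T_cs/T_s + N₀² T_cs/(D₂ T_s) + β(0,0) (N₀/D₂) E_k)`. -/
theorem stmt5 {L Mtx Mrx : ℕ} (hL : 0 < L) (hMtx : 0 < Mtx) (hMrx : 0 < Mrx)
    (α : Fin L → ℂ) (arx : Fin L → Fin Mrx → ℂ) (atx : Fin L → Fin Mtx → ℂ)
    (τhat τ : Fin L → ℝ) (fc fk : ℝ) (t : Fin Mtx → ℂ)
    (horth : ∀ ℓ m, ℓ ≠ m → dotc (arx ℓ) (arx m) = 0)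
    (hnorm : ∀ ℓ, dotc (arx ℓ) (arx ℓ) = (Mrx : ℂ))
    {Ω : Type*} [MeasureSpace Ω] [IsProbabilityMeasure (ℙ : Measure Ω)]
    (W : Ω → Fin Mrx → ℂ)
    (N0 D2 Er Ek Tcs Ts v θbar : ℝ)
    (hN0 : 0 < N0) (hD2 : 0 < D2) (hEr : 0 < Er) (hEk : 0 < Ek)
    (hTcs : 0 < Tcs) (hTs : 0 < Ts) (hv : 0 ≤ v)
    (hWL2 : ∀ m, MemLp (fun ω => W ω m) 2 ℙ)
    (hWmean : ∀ m, (∫ ω, W ω m) = 0)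
    (hWcov : ∀ m n, (∫ ω, W ω m * (starRingEnd ℂ) (W ω n))
      = if m = n then ((N0 / D2 : ℝ) : ℂ) else 0)
    (μ : Fin Mrx → ℂ)
    (hμ : μ = fun i => ((Real.sqrt Er : ℝ) : ℂ) * Complex.exp ((-θbar : ℝ) * Complex.I) *
      ((Real.exp (-(v / 2)) : ℝ) : ℂ) * (chanMat α arx atx τhat fc).mulVec t i)
    (hvec : Fin Mrx → ℂ)
    (hhvec : hvec = (chanMat α arx atx τ (fc + fk)).mulVec t)
    (Z : Ω → ℝ)
    (hZ : Z = fun ω => (∑ i, ‖μ i + W ω i‖ ^ 2) * N0 * Tcs / Ts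
      + ‖dotc (W ω) hvec‖ ^ 2 * Ek) :
    (∫ ω, Z ω)
      = Mrx * (betaZero α atx t * Er * Real.exp (-v) * N0 * Tcs / Ts
        + N0 ^ 2 * Tcs / (D2 * Ts)
        + betaZero α atx t * (N0 / D2) * Ek) := by
  have hμsum : ∑ i, ‖μ i‖ ^ 2 = Er * Real.exp (-v) * (Mrx * betaZero α atx t) := by
    rw [← sum_norm_sq_chanMat_mulVec α arx atx horth hnorm τhat fc t, hμ, Finset.mul_sum]
    refine Finset.sum_congr rfl fun i _ => ?_
    have hexp : Real.exp (-(v / 2)) ^ 2 = Real.exp (-v) := by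
      rw [← Real.exp_nat_mul]
      congr 1
      push_cast
      ring
    rw [norm_mul, norm_mul, norm_mul, Complex.norm_exp_ofReal_mul_I, Complex.norm_real,
      Complex.norm_real, Real.norm_eq_abs, Real.norm_eq_abs, mul_pow, mul_pow, mul_pow, sq_abs,
      sq_abs, Real.sq_sqrt hEr.le, hexp, one_pow, mul_one]
  have hterm : ∀ i, ∫ ω, ‖μ i + W ω i‖ ^ 2 = ‖μ i‖ ^ 2 + N0 / D2 := by
    intro i
    apply Complex.ofReal_injective
    rw [integral_norm_const_add_sq (hWL2 i) (hWmean i), hWcov, if_pos rfl]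
    push_cast
    rfl
  have hint : ∀ i, Integrable (fun ω => ‖μ i + W ω i‖ ^ 2) :=
    fun i => integrable_norm_const_add_sq (hWL2 i) (μ i)
  have hI : ∫ ω, ∑ i, ‖μ i + W ω i‖ ^ 2 =
      Er * Real.exp (-v) * (Mrx * betaZero α atx t) + Mrx * (N0 / D2) := by
    rw [integral_finsetSum _ fun i _ => hint i]
    simp only [hterm, Finset.sum_add_distrib, hμsum, Finset.sum_const, Finset.card_univ,
      Fintype.card_fin, nsmul_eq_mul]
  have hh : ∫ ω, ‖dotc (W ω) hvec‖ ^ 2 = N0 / D2 * (Mrx * betaZero α atx t) := by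
    rw [integral_norm_dotc_sq hWL2 hWcov, hhvec,
      sum_norm_sq_chanMat_mulVec α arx atx horth hnorm]
  have hIint : Integrable (fun ω => (∑ i, ‖μ i + W ω i‖ ^ 2) * N0 * Tcs / Ts) :=
    (((integrable_finsetSum _ fun i _ => hint i).mul_const N0).mul_const Tcs).div_const Ts
  rw [hZ, integral_add hIint ((integrable_norm_dotc_sq hWL2 hvec).mul_const Ek),
    integral_div, integral_mul_const, integral_mul_const, integral_mul_const, hI, hh]
  field_simp
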